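/- Let G be a finite pseudo-solvable group. Then at least one of the following holds: (1) {2,3,5} does not form a triangle in the complement of the prime graph of G (i.e., G contains an element of order 6, 10, or 15, or one of 2,3,5 does not divide |G|); or (2) for every prime p dividing |G| with p ∉ {2,3,5}, the pair 2-p is not an edge in the complement of the prime graph of G (i.e., if 2 and p both divide |G| then G contains an element of order 2p). -/

import Mathlib

/-- A finite group is *pseudo-solvable* if it has a composition series all of whose
factors are cyclic (of prime order) or isomorphic to the alternating group `A₅`.
The factor of a step of the series is expressed as the image of a surjective
homomorphism whose kernel is the previous term. -/
def IsPseudoSolvable (G : Type*) [Group G] : Prop :=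
  ∃ (n : ℕ) (c : Fin (n + 1) → Subgroup G),
    c 0 = ⊥ ∧ c (Fin.last n) = ⊤ ∧
    ∀ i : Fin n,
      c i.castSucc ≤ c i.succ ∧
      ∃ (S : Type) (_ : Group S) (f : ↥(c i.succ) →* S),
        Function.Surjective f ∧
        f.ker = (c i.castSucc).subgroupOf (c i.succ) ∧
        IsSimpleGroup S ∧
        (IsCyclic S ∨ Nonempty (S ≃* alternatingGroup (Fin 5)))

lemma exists_orderOf_eq_of_dvd {G : Type*} [Group G] [Finite G] {g : G} {n : ℕ}
    (h : n ∣ orderOf g) : ∃ x : G, orderOf x = n :=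
  ⟨_, orderOf_pow_orderOf_div (orderOf_pos g).ne' h⟩

lemma exists_orderOf_eq_mul_of_commute {G : Type*} [Group G] {x y : G} {m n : ℕ}
    (hx : orderOf x = m) (hy : orderOf y = n) (hc : Commute x y) (hmn : m.Coprime n) :
    ∃ g : G, orderOf g = m * n :=
  ⟨x * y, by rw [hc.orderOf_mul_eq_mul_orderOf_of_coprime (by rwa [hx, hy]), hx, hy]⟩

lemma exists_orderOf_eq_of_map {G Q : Type*} [Group G] [Finite G] [Group Q] (f : G →* Q)
    (hf : Function.Surjective f) {n : ℕ} (h : ∃ q : Q, orderOf q = n) : ∃ g : G, orderOf g = n := by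
  obtain ⟨q, rfl⟩ := h
  obtain ⟨g, rfl⟩ := hf q
  exact exists_orderOf_eq_of_dvd (orderOf_map_dvd f g)

lemma exists_orderOf_eq_of_subgroup {G : Type*} [Group G] (H : Subgroup G) {n : ℕ}
    (h : ∃ q : H, orderOf q = n) : ∃ g : G, orderOf g = n := by
  obtain ⟨q, rfl⟩ := h
  exact ⟨q, Subgroup.orderOf_coe q⟩

lemma card_eq_card_mul_card_ker {G Q : Type*} [Group G] [Group Q] (f : G →* Q)
    (hf : Function.Surjective f) : Nat.card G = Nat.card Q * Nat.card f.ker := by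
  rw [Subgroup.card_eq_card_quotient_mul_card_subgroup f.ker,
    Nat.card_congr (QuotientGroup.quotientKerEquivOfSurjective f hf).toEquiv]

/-- The Frattini argument: the normalizer of a Sylow subgroup of the kernel still maps onto the
target. -/
lemma exists_mem_normalizer_map_eq {G Q : Type*} [Group G] [Finite G] [Group Q] (f : G →* Q)
    (hf : Function.Surjective f) {p : ℕ} [Fact p.Prime] (P : Sylow p f.ker) (q : Q) :
    ∃ x ∈ Subgroup.normalizer (P.map f.ker.subtype : Set G), f x = q := by
  obtain ⟨g, rfl⟩ := hf q
  have hg : g ∈ Subgroup.normalizer (P.map f.ker.subtype : Set G) ⊔ f.ker := by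
    rw [Sylow.normalizer_sup_eq_top P]; trivial
  obtain ⟨x, hx, k, hk, rfl⟩ := Subgroup.mem_sup_of_normal_right.1 hg
  exact ⟨x, hx, by rw [map_mul, MonoidHom.mem_ker.1 hk, mul_one]⟩

lemma exists_mem_normalizer_orderOf {G Q : Type*} [Group G] [Finite G] [Group Q] (f : G →* Q)
    (hf : Function.Surjective f) {p : ℕ} [Fact p.Prime] (P : Sylow p f.ker)
    {b : ℕ} [Fact b.Prime] (hb : b ∣ Nat.card Q) :
    ∃ x ∈ Subgroup.normalizer (P.map f.ker.subtype : Set G), orderOf x = b := by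
  have hs : Function.Surjective
      (f.comp (Subgroup.normalizer (P.map f.ker.subtype : Set G)).subtype) := fun q ↦ by
    obtain ⟨x, hx, rfl⟩ := exists_mem_normalizer_map_eq f hf P q
    exact ⟨⟨x, hx⟩, rfl⟩
  have : Finite Q := Finite.of_surjective f hf
  obtain ⟨x, hx⟩ :=
    exists_orderOf_eq_of_map _ hs (exists_prime_orderOf_dvd_card' (G := Q) b hb)
  exact ⟨x, x.2, by simpa using hx⟩

/-- An automorphism of order dividing two of a finite group without nontrivial fixed points is the
inversion. -/
lemma apply_eq_inv_of_fixedPointFree {N : Type*} [Group N] [Finite N] (σ : MulAut N)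
    (h2 : σ ^ 2 = 1) (hσ : ∀ n : N, σ n = n → n = 1) (n : N) : σ n = n⁻¹ := by
  have hi : Function.Involutive σ := fun x ↦ by
    rw [← MulAut.mul_apply, ← sq, h2, MulAut.one_apply]
  exact congrFun (MonoidHom.FixedPointFree.coe_eq_inv_of_involutive (φ := σ) hσ hi) n

/-- If commuting elements `z`, `w` of prime order `a` generate a noncyclic group that acts
on an abelian group so that each of `w`, `z * w`, ..., and `z` has no nontrivial fixed point,
then the abelian group has exponent dividing `a`. -/
lemma pow_eq_one_of_free {H N : Type*} [Group H] [CommGroup N] (φ : H →* MulAut N) {a : ℕ}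
    [Fact a.Prime] (hfree : ∀ h : H, orderOf h = a → ∀ n : N, φ h n = n → n = 1) {z w : H}
    (hz : orderOf z = a) (hw : w ^ a = 1) (hc : Commute z w) (hzw : w ∉ Subgroup.zpowers z)
    (n : N) : n ^ a = 1 := by
  have ha : a.Prime := Fact.out
  have key : ∀ h : H, orderOf h = a → ∀ m : N, ∏ j ∈ Finset.range a, φ (h ^ j) m = 1 := by
    intro h hh m
    apply hfree h hh
    rw [map_prod]
    have : ∀ j, φ h (φ (h ^ j) m) = φ (h ^ (j + 1)) m := fun j ↦ by
      rw [← MulAut.mul_apply, ← map_mul, ← pow_succ']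
    simp_rw [this]
    have h1 := Finset.prod_range_succ (fun j ↦ φ (h ^ j) m) a
    rw [Finset.prod_range_succ'] at h1
    have h2 : h ^ a = 1 := by rw [← hh, pow_orderOf_eq_one]
    simpa [h2] using h1
  have hord : ∀ i : ℕ, orderOf (z ^ i * w) = a := by
    intro i
    apply orderOf_eq_prime
    · rw [(hc.pow_left i).mul_pow, hw, mul_one, ← pow_mul, mul_comm, pow_mul, ← hz,
        pow_orderOf_eq_one, one_pow]
    · intro h
      apply hzw
      rw [← inv_eq_of_mul_eq_one_right h]
      exact inv_mem (pow_mem (Subgroup.mem_zpowers z) i)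
  have h1 : ∏ i ∈ Finset.range a, ∏ j ∈ Finset.range a, φ ((z ^ i * w) ^ j) n = 1 :=
    Finset.prod_eq_one fun i _ ↦ key _ (hord i) n
  rw [Finset.prod_comm, Finset.prod_eq_single 0] at h1
  · simpa using h1
  · intro j hj hj0
    have hzj : orderOf (z ^ j) = a := by
      rw [Nat.Coprime.orderOf_pow, hz]
      rw [hz]
      exact Nat.coprime_of_lt_prime hj0 (Finset.mem_range.1 hj) ha
    rw [← key _ hzj (φ (w ^ j) n)]
    refine Finset.prod_congr rfl fun i _ ↦ ?_
    rw [(hc.pow_left i).mul_pow, map_mul, MulAut.mul_apply, ← pow_mul, ← pow_mul, mul_comm i j]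
  · intro h
    exact absurd (Finset.mem_range.2 ha.pos) h

lemma commute_of_conj_eq_pow {H : Type*} [Group H] {a b k : ℕ} [Fact a.Prime] {y z : H}
    (hz : orderOf z = a) (hy : y ^ b = 1) (hyz : y * z * y⁻¹ = z ^ k)
    (hab : b.Coprime (a - 1)) (hb : b ≠ 0) : Commute y z := by
  have hs : SemiconjBy y z (z ^ k) := by
    rw [SemiconjBy, ← hyz, inv_mul_cancel_right]
  have hj : ∀ j : ℕ, SemiconjBy (y ^ j) z (z ^ k ^ j) := by
    intro j
    induction j with
    | zero => simp
    | succ j ih =>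
      rw [pow_succ, pow_succ k, pow_mul]
      exact (ih.pow_right k).mul_left hs
  have h1 := hj b
  rw [hy, SemiconjBy, one_mul, mul_one] at h1
  have h2 : k ^ b ≡ 1 [MOD a] := by
    rw [← hz, ← pow_eq_pow_iff_modEq, pow_one, ← h1]
  have h3 : (k : ZMod a) ^ b = 1 := by
    have := (ZMod.natCast_eq_natCast_iff _ _ _).2 h2
    simpa using this
  have hk0 : (k : ZMod a) ≠ 0 := by
    intro h
    rw [h, zero_pow hb] at h3
    exact zero_ne_one h3
  have h4 : (k : ZMod a) = 1 := by
    rw [← orderOf_eq_one_iff, ← Nat.dvd_one, ← hab]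
    exact Nat.dvd_gcd (orderOf_dvd_of_pow_eq_one h3)
      (orderOf_dvd_of_pow_eq_one (ZMod.pow_card_sub_one_eq_one hk0))
  have h5 : k ≡ 1 [MOD a] := by
    rw [← ZMod.natCast_eq_natCast_iff, h4, Nat.cast_one]
  have h6 : z ^ k = z := by
    conv_rhs => rw [← pow_one z]
    rw [pow_eq_pow_iff_modEq, hz]
    exact h5
  rwa [h6] at hs

lemma exists_mem_center_orderOf_eq {H : Type*} [Group H] [Finite H] {a : ℕ} [Fact a.Prime]
    (P : Subgroup H) (hP : IsPGroup a P) (hP1 : P ≠ ⊥) :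
    ∃ z ∈ P, orderOf z = a ∧ ∀ x ∈ P, Commute z x := by
  have : Nontrivial P := (Subgroup.nontrivial_iff_ne_bot P).2 hP1
  have := hP.center_nontrivial
  have hc : IsPGroup a (Subgroup.center P) := hP.to_subgroup _
  obtain ⟨n, hn, hcard⟩ := hc.nontrivial_iff_card.1 this
  obtain ⟨z, hz⟩ := exists_prime_orderOf_dvd_card' (G := Subgroup.center P) a
    (hcard ▸ dvd_pow_self a hn.ne')
  refine ⟨z, z.1.2, by rw [Subgroup.orderOf_coe, Subgroup.orderOf_coe, hz], fun x hx ↦ ?_⟩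
  have := Subgroup.mem_center_iff.1 z.2 ⟨x, hx⟩
  exact (congrArg Subtype.val this).symm

/-- If `y` of prime order `b` normalizes an `a`-group whose elements of order `a` act without
nontrivial fixed points, and `b` is coprime to `a - 1`, then there is an element of order
`a * b`. -/
lemma exists_orderOf_eq_mul_of_normalizer {H N : Type*} [Group H] [Finite H] [CommGroup N]
    (φ : H →* MulAut N) {a b : ℕ} [Fact a.Prime] [Fact b.Prime] (hab : b.Coprime (a - 1))
    (hne : a ≠ b) (hfree : ∀ h : H, orderOf h = a → ∀ n : N, φ h n = n → n = 1)
    (hN : ∃ n : N, n ^ a ≠ 1) (P : Subgroup H) (hP : IsPGroup a P) (hP1 : P ≠ ⊥)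
    {y : H} (hyP : y ∈ Subgroup.normalizer (P : Set H)) (hy : orderOf y = b) :
    ∃ g : H, orderOf g = a * b := by
  obtain ⟨z, hzP, hz, hzc⟩ := exists_mem_center_orderOf_eq P hP hP1
  have hwP : y * z * y⁻¹ ∈ P := (Subgroup.mem_normalizer_iff.1 hyP z).1 hzP
  have hmem : y * z * y⁻¹ ∈ Subgroup.zpowers z := by
    by_contra hw
    obtain ⟨n, hn⟩ := hN
    refine hn (pow_eq_one_of_free φ hfree hz ?_ (hzc _ hwP) hw n)
    rw [conj_pow, ← hz, pow_orderOf_eq_one, mul_one, mul_inv_cancel]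
  rw [← mem_powers_iff_mem_zpowers] at hmem
  obtain ⟨k, hk⟩ := hmem
  have hc := commute_of_conj_eq_pow hz (by rw [← hy, pow_orderOf_eq_one]) hk.symm hab
    (Nat.Prime.ne_zero Fact.out)
  exact exists_orderOf_eq_mul_of_commute hz hy hc.symm
    ((Nat.coprime_primes Fact.out Fact.out).2 hne)

lemma exists_orderOf_eq_mul_of_ker {H Q N : Type*} [Group H] [Finite H] [Group Q]
    [CommGroup N] (f : H →* Q) (hf : Function.Surjective f)
    (φ : H →* MulAut N) {a b : ℕ} [Fact a.Prime] [Fact b.Prime] (hab : b.Coprime (a - 1))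
    (hne : a ≠ b) (hfree : ∀ h : H, orderOf h = a → ∀ n : N, φ h n = n → n = 1)
    (hN : ∃ n : N, n ^ a ≠ 1) (ha : a ∣ Nat.card f.ker) (hb : b ∣ Nat.card Q) :
    ∃ g : H, orderOf g = a * b := by
  let P : Sylow a f.ker := default
  obtain ⟨y, hy, hyb⟩ := exists_mem_normalizer_orderOf f hf P hb
  refine exists_orderOf_eq_mul_of_normalizer φ hab hne hfree hN _ (P.2.map _) ?_ hy hyb
  rw [Ne, Subgroup.map_eq_bot_iff_of_injective _ f.ker.subtype_injective]
  exact P.ne_bot_of_dvd_card ha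

theorem exists_orderOf_eq_fifteen_of_free {H N : Type*} [Group H] [Finite H] [Group.IsSolvable H]
    [CommGroup N] (φ : H →* MulAut N)
    (hfree : ∀ h : H, orderOf h = 3 ∨ orderOf h = 5 → ∀ n : N, φ h n = n → n = 1)
    (hN3 : ∃ n : N, n ^ 3 ≠ 1) (hN5 : ∃ n : N, n ^ 5 ≠ 1)
    (h3 : 3 ∣ Nat.card H) (h5 : 5 ∣ Nat.card H) : ∃ g : H, orderOf g = 15 := by
  have p3 : Fact (Nat.Prime 3) := ⟨by norm_num⟩
  have p5 : Fact (Nat.Prime 5) := ⟨by norm_num⟩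
  induction hn : Nat.card H using Nat.strong_induction_on generalizing H with
  | _ n ih =>
  have hnt : Nontrivial H := by
    rw [← Finite.one_lt_card_iff_nontrivial]
    exact lt_of_lt_of_le (by norm_num) (Nat.le_of_dvd Nat.card_pos h3)
  let f : H →* Abelianization H := Abelianization.of
  have hf : Function.Surjective f := QuotientGroup.mk_surjective
  have hker : f.ker = commutator H := Abelianization.ker_of H
  have hcard := card_eq_card_mul_card_ker f hf
  rw [hcard, Nat.Prime.dvd_mul Fact.out] at h3 h5
  by_cases k3 : 3 ∣ Nat.card f.ker <;> by_cases k5 : 5 ∣ Nat.card f.ker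
  · refine exists_orderOf_eq_of_subgroup f.ker (ih (Nat.card f.ker) ?_ (φ.comp f.ker.subtype)
      (fun h hh ↦ hfree h (by rw [Subgroup.orderOf_coe]; exact hh)) k3 k5 rfl)
    rw [← hn]
    refine lt_of_le_of_ne (Subgroup.card_le_card_group _) fun h ↦ ?_
    have := Group.IsSolvable.commutator_lt_top_of_nontrivial H
    rw [← hker, Subgroup.eq_top_of_card_eq _ h] at this
    exact lt_irrefl _ this
  · exact exists_orderOf_eq_mul_of_ker (a := 3) (b := 5) f hf φ (by norm_num) (by norm_num)
      (fun h hh ↦ hfree h (Or.inl hh)) hN3 k3 (h5.resolve_right k5)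
  · exact exists_orderOf_eq_mul_of_ker (a := 5) (b := 3) f hf φ (by norm_num) (by norm_num)
      (fun h hh ↦ hfree h (Or.inr hh)) hN5 k5 (h3.resolve_right k3)
  · have : Finite (Abelianization H) := Finite.of_surjective f hf
    obtain ⟨x, hx⟩ := exists_prime_orderOf_dvd_card' (G := Abelianization H) 3
      (h3.resolve_right k3)
    obtain ⟨y, hy⟩ := exists_prime_orderOf_dvd_card' (G := Abelianization H) 5
      (h5.resolve_right k5)
    exact exists_orderOf_eq_of_map f hf
      (exists_orderOf_eq_mul_of_commute hx hy (Commute.all x y) (by norm_num))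

lemma exists_normal_elementary_abelian (G : Type*) [Group G] [Finite G] [Group.IsSolvable G]
    [Nontrivial G] : ∃ (r : ℕ) (N : Subgroup G), r.Prime ∧ N.Normal ∧ N ≠ ⊥ ∧
      (∀ x ∈ N, x ^ r = 1) ∧ ∀ x ∈ N, ∀ y ∈ N, Commute x y := by
  classical
  have hex : ∃ n, derivedSeries G n = ⊥ := Group.IsSolvable.solvable
  obtain ⟨k, hk⟩ : ∃ k, Nat.find hex = k + 1 := by
    refine Nat.exists_eq_succ_of_ne_zero fun h ↦ ?_
    have := Nat.find_spec hex
    rw [h, derivedSeries_zero] at this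
    exact top_ne_bot this
  have hbot : ⁅derivedSeries G k, derivedSeries G k⁆ = ⊥ := by
    rw [← derivedSeries_succ, ← hk]; exact Nat.find_spec hex
  have hne : derivedSeries G k ≠ ⊥ := Nat.find_min hex (by omega)
  have hcomm : ∀ x ∈ derivedSeries G k, ∀ y ∈ derivedSeries G k, Commute x y := by
    intro x hx y hy
    have := (Subgroup.commutator_eq_bot_iff_le_centralizer.1 hbot) hx
    exact (Subgroup.mem_centralizer_iff.1 this y hy).symm
  have hnorm : (derivedSeries G k).Normal := derivedSeries_normal G k
  obtain ⟨r, hr, hdvd⟩ := Nat.exists_prime_and_dvd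
    (fun h ↦ hne ((derivedSeries G k).eq_bot_of_card_eq h))
  have : Fact r.Prime := ⟨hr⟩
  obtain ⟨x, hx⟩ := exists_prime_orderOf_dvd_card' (G := derivedSeries G k) r hdvd
  let N : Subgroup G :=
    { carrier := {x | x ∈ derivedSeries G k ∧ x ^ r = 1}
      mul_mem' := fun ha hb ↦
        ⟨mul_mem ha.1 hb.1, by rw [(hcomm _ ha.1 _ hb.1).mul_pow, ha.2, hb.2, one_mul]⟩
      one_mem' := ⟨one_mem _, one_pow r⟩
      inv_mem' := fun ha ↦ ⟨inv_mem ha.1, by rw [inv_pow, ha.2, inv_one]⟩ }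
  refine ⟨r, N, hr, ⟨fun n hn g ↦ ⟨hnorm.conj_mem n hn.1 g, ?_⟩⟩, ?_, fun x hx ↦ hx.2,
    fun x hx y hy ↦ hcomm x hx.1 y hy.1⟩
  · rw [conj_pow, hn.2, mul_one, mul_inv_cancel]
  · intro h
    have hxN : (x : G) ∈ N :=
      ⟨x.2, by rw [← Subgroup.orderOf_coe] at hx; rw [← hx, pow_orderOf_eq_one]⟩
    rw [h, Subgroup.mem_bot, ← orderOf_eq_one_iff, Subgroup.orderOf_coe, hx] at hxN
    exact hr.ne_one hxN

/-- If an involution `t` and an element `y` of odd prime order both act without nontrivial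
fixed points on a group `N`, then there is an element of order `2 * orderOf y`. -/
lemma exists_orderOf_eq_two_mul_of_free {G N : Type*} [Group G] [Finite G] [Group N] [Finite N]
    [Nontrivial N] (φ : G →* MulAut N) {q : ℕ} (hq : q.Prime) (hq2 : q ≠ 2) {t y : G}
    (ht : orderOf t = 2) (hy : orderOf y = q) (htf : ∀ n : N, φ t n = n → n = 1)
    (hyf : ∀ n : N, φ y n = n → n = 1) : ∃ g : G, orderOf g = 2 * q := by
  have : Fact q.Prime := ⟨hq⟩
  have ht2 : φ t ^ 2 = 1 := by rw [← map_pow, ← ht, pow_orderOf_eq_one, map_one]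
  have hne : ∀ g : G, (∀ n : N, φ g n = n → n = 1) → φ g ≠ 1 := by
    intro g hg h
    obtain ⟨n, hn⟩ := exists_ne (1 : N)
    exact hn (hg n (by rw [h, MulAut.one_apply]))
  have hinv := apply_eq_inv_of_fixedPointFree _ ht2 htf
  have hc : Commute (φ t) (φ y) := by
    ext n
    rw [MulAut.mul_apply, MulAut.mul_apply, hinv, hinv, map_inv]
  have h1 : orderOf (φ t) = 2 := orderOf_eq_prime ht2 (hne t htf)
  have h2 : orderOf (φ y) = q :=
    orderOf_eq_prime (by rw [← map_pow, ← hy, pow_orderOf_eq_one, map_one]) (hne y hyf)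
  have h3 : orderOf (φ (t * y)) = 2 * q := by
    rw [map_mul, hc.orderOf_mul_eq_mul_orderOf_of_coprime, h1, h2]
    rw [h1, h2]
    exact (Nat.coprime_primes Nat.prime_two hq).2 hq2.symm
  exact exists_orderOf_eq_of_dvd (h3 ▸ orderOf_map_dvd φ (t * y))

lemma conjNormal_apply_eq_self_iff {G : Type*} [Group G] {N : Subgroup G} [N.Normal] {g : G}
    {n : N} : MulAut.conjNormal g n = n ↔ Commute g n := by
  rw [Subtype.ext_iff, MulAut.conjNormal_apply, mul_inv_eq_iff_eq_mul]
  rfl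

/-- The primes `2`, `3` and `5` do not form a triangle in the complement of the prime graph of a
finite solvable group. -/
theorem exists_orderOf_eq_of_isSolvable {G : Type*} [Group G] [Finite G] [Group.IsSolvable G]
    (h2 : 2 ∣ Nat.card G) (h3 : 3 ∣ Nat.card G) (h5 : 5 ∣ Nat.card G) :
    ∃ g : G, orderOf g = 6 ∨ orderOf g = 10 ∨ orderOf g = 15 := by
  have p2 : Fact (Nat.Prime 2) := ⟨by norm_num⟩
  have p3 : Fact (Nat.Prime 3) := ⟨by norm_num⟩
  have p5 : Fact (Nat.Prime 5) := ⟨by norm_num⟩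
  induction hn : Nat.card G using Nat.strong_induction_on generalizing G with
  | _ n ih =>
  have hnt : Nontrivial G := by
    rw [← Finite.one_lt_card_iff_nontrivial]
    exact lt_of_lt_of_le (by norm_num) (Nat.le_of_dvd Nat.card_pos h3)
  obtain ⟨r, N, hr, hN, hN1, hNr, hcomm⟩ := exists_normal_elementary_abelian G
  have : Fact r.Prime := ⟨hr⟩
  have hntN : Nontrivial N := (Subgroup.nontrivial_iff_ne_bot N).2 hN1
  by_contra hcon
  push Not at hcon
  let _ : CommGroup N :=
    { (inferInstance : Group N) with
      mul_comm := fun x y ↦ Subtype.ext (hcomm x x.2 y y.2) }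
  have hfree : ∀ h : G, (orderOf h).Coprime r → (∀ g : G, orderOf g ≠ orderOf h * r) →
      ∀ n : N, MulAut.conjNormal h n = n → n = 1 := by
    intro h hh hhr n hn
    by_contra hn1
    rw [conjNormal_apply_eq_self_iff] at hn
    have hnr : orderOf (n : G) = r :=
      orderOf_eq_prime (hNr n n.2) (fun h ↦ hn1 (Subtype.ext h))
    obtain ⟨g, hg⟩ := exists_orderOf_eq_mul_of_commute rfl hnr hn hh
    exact hhr g hg
  by_cases hr2 : r = 2
  · subst hr2
    obtain ⟨m, hm⟩ := exists_ne (1 : N)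
    have hm2 : m ^ 2 = 1 := Subtype.ext (hNr m m.2)
    obtain ⟨g, hg⟩ := exists_orderOf_eq_fifteen_of_free (MulAut.conjNormal : G →* MulAut N)
      (by
        rintro h (hh | hh)
        · exact hfree h (by rw [hh]; norm_num) fun g ↦ by rw [hh]; exact (hcon g).1
        · exact hfree h (by rw [hh]; norm_num) fun g ↦ by rw [hh]; exact (hcon g).2.1)
      ⟨m, by rwa [pow_succ, hm2, one_mul]⟩
      ⟨m, by rwa [pow_succ, pow_mul m 2 2, hm2, one_pow, one_mul]⟩ h3 h5
    exact (hcon g).2.2 hg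
  by_cases hr35 : r = 3 ∨ r = 5
  · obtain ⟨t, ht⟩ := exists_prime_orderOf_dvd_card' 2 h2
    obtain ⟨y3, hy3⟩ := exists_prime_orderOf_dvd_card' 3 h3
    obtain ⟨y5, hy5⟩ := exists_prime_orderOf_dvd_card' 5 h5
    rcases hr35 with rfl | rfl
    · obtain ⟨g, hg⟩ := exists_orderOf_eq_two_mul_of_free (MulAut.conjNormal : G →* MulAut N)
        Nat.prime_five (by norm_num) ht hy5
        (hfree t (by rw [ht]; norm_num) fun g ↦ by rw [ht]; exact (hcon g).1)
        (hfree y5 (by rw [hy5]; norm_num) fun g ↦ by rw [hy5]; exact (hcon g).2.2)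
      exact (hcon g).2.1 hg
    · obtain ⟨g, hg⟩ := exists_orderOf_eq_two_mul_of_free (MulAut.conjNormal : G →* MulAut N)
        Nat.prime_three (by norm_num) ht hy3
        (hfree t (by rw [ht]; norm_num) fun g ↦ by rw [ht]; exact (hcon g).2.1)
        (hfree y3 (by rw [hy3]; norm_num) fun g ↦ by rw [hy3]; exact (hcon g).2.2)
      exact (hcon g).1 hg
  · push Not at hr35
    have hNp : IsPGroup r N := fun x ↦ ⟨1, Subtype.ext (by simpa using hNr x x.2)⟩
    obtain ⟨e, he⟩ := IsPGroup.iff_card.1 hNp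
    have hcard := N.card_eq_card_quotient_mul_card_subgroup
    have hdvd : ∀ s : ℕ, s.Prime → s ≠ r → s ∣ Nat.card G → s ∣ Nat.card (G ⧸ N) := by
      intro s hs hsr hsG
      rw [hcard, he] at hsG
      exact (((Nat.coprime_primes hs hr).2 hsr).pow_right e).dvd_of_dvd_mul_right hsG
    obtain ⟨q, hq⟩ := ih (Nat.card (G ⧸ N))
      (by
        rw [← hn, hcard]
        exact lt_mul_of_one_lt_right Nat.card_pos (Finite.one_lt_card_iff_nontrivial.2 hntN))
      (hdvd 2 Nat.prime_two (Ne.symm hr2) h2) (hdvd 3 Nat.prime_three hr35.1.symm h3)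
      (hdvd 5 Nat.prime_five hr35.2.symm h5) rfl
    have hlift : ∀ m : ℕ, orderOf q = m → ∃ g : G, orderOf g = m := fun m hm ↦
      exists_orderOf_eq_of_map (QuotientGroup.mk' N) (QuotientGroup.mk'_surjective N) ⟨q, hm⟩
    rcases hq with hq | hq | hq <;> obtain ⟨g, hg⟩ := hlift _ hq
    · exact (hcon g).1 hg
    · exact (hcon g).2.1 hg
    · exact (hcon g).2.2 hg

lemma apply_eq_one_of_apply_mulAut_eq_one {D Q : Type*} [Group D] [Finite D] [Group Q]
    [IsSimpleGroup Q] (f : D →* Q) (hf : Function.Surjective f) (h2 : ∃ q : Q, orderOf q = 2)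
    (h3 : ∃ q : Q, orderOf q = 3) (h6 : ∀ g : D, orderOf g ≠ 6) (σ : MulAut D) {x : D}
    (hx : f (σ x) = 1) : f x = 1 := by
  let f' : D →* Q := f.comp σ.toMonoidHom
  have hf' : Function.Surjective f' := hf.comp σ.surjective
  rcases (inferInstance : f'.ker.Normal).map f hf |>.eq_bot_or_eq_top with h | h
  · exact (Subgroup.mem_bot.1 (h ▸ Subgroup.mem_map_of_mem f (show x ∈ f'.ker from hx)))
  · exfalso
    obtain ⟨a, ha⟩ := h2
    obtain ⟨b, hb⟩ := h3
    obtain ⟨d, rfl⟩ := hf' a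
    obtain ⟨k, hk, hkb⟩ : (f d)⁻¹ * b ∈ f'.ker.map f := h ▸ Subgroup.mem_top _
    have e1 : f' (d * k) = f' d := by rw [map_mul, MonoidHom.mem_ker.1 hk, mul_one]
    have e2 : f (d * k) = b := by rw [map_mul, hkb, mul_inv_cancel_left]
    have d2 : 2 ∣ orderOf (d * k) := by rw [← ha, ← e1]; exact orderOf_map_dvd f' _
    have d3 : 3 ∣ orderOf (d * k) := by rw [← hb, ← e2]; exact orderOf_map_dvd f _
    obtain ⟨g, hg⟩ := exists_orderOf_eq_of_dvd
      (Nat.Coprime.mul_dvd_of_dvd_of_dvd (by norm_num) d2 d3 : 2 * 3 ∣ _)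
    exact h6 g hg

lemma exists_fixed_point_of_card_range_eq_four {T Q : Type*} [Group T] [Finite T] [Group Q]
    (g : T →* Q) (hT : IsPGroup 2 T) (hg : Nat.card g.range = 4) {p : ℕ} (hp : p.Prime)
    (hp2 : p ≠ 2) (hp3 : p ≠ 3) (τ : Equiv.Perm T) (hτ : τ ^ p = 1)
    (h : ∀ x, g x ≠ 1 → g (τ x) ≠ 1) : ∃ x : T, x ≠ 1 ∧ τ x = x := by
  classical
  have : Fact p.Prime := ⟨hp⟩
  have : Fintype T := Fintype.ofFinite T
  let τ' : Equiv.Perm {x : T // g x ≠ 1} := τ.subtypePermOfFintype h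
  have hcard : Nat.card T = 4 * Nat.card g.ker := by
    rw [card_eq_card_mul_card_ker g.rangeRestrict g.rangeRestrict_surjective, hg,
      MonoidHom.ker_rangeRestrict]
  have hX : Fintype.card {x : T // g x ≠ 1} = 3 * Nat.card g.ker := by
    rw [Fintype.card_subtype_compl, ← Nat.card_eq_fintype_card, ← Nat.card_eq_fintype_card, hcard]
    change 4 * Nat.card g.ker - Nat.card g.ker = _
    omega
  obtain ⟨e, he⟩ := IsPGroup.iff_card.1 (hT.to_subgroup g.ker)
  have hndvd : ¬ p ∣ Fintype.card {x : T // g x ≠ 1} := by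
    rw [hX, he, hp.dvd_mul]
    rintro (h | h)
    · exact hp3 ((Nat.prime_dvd_prime_iff_eq hp Nat.prime_three).1 h)
    · exact hp2 ((Nat.prime_dvd_prime_iff_eq hp Nat.prime_two).1 (hp.dvd_of_dvd_pow h))
  have hτ' : τ' ^ p ^ 1 = 1 := by
    have hpow : ∀ (m : ℕ) (x : {x : T // g x ≠ 1}), ((τ' ^ m) x : T) = (τ ^ m) x := by
      intro m
      induction m with
      | zero => simp
      | succ m ih =>
        intro x
        rw [pow_succ', pow_succ', Equiv.Perm.mul_apply, Equiv.Perm.mul_apply, ← ih]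
        rfl
    ext x
    rw [pow_one, hpow, hτ]
    rfl
  obtain ⟨x, hx⟩ := Equiv.Perm.exists_fixed_point_of_prime hndvd hτ'
  exact ⟨x, fun h1 ↦ x.2 (by rw [h1, map_one]), congrArg Subtype.val hx⟩

lemma card_alternatingGroup_five : Nat.card (alternatingGroup (Fin 5)) = 60 := by
  rw [nat_card_alternatingGroup]
  simp [Nat.factorial]

lemma exists_orderOf_alternatingGroup_five {q : ℕ} (hq : q.Prime) (h : q ∣ 60) :
    ∃ x : alternatingGroup (Fin 5), orderOf x = q :=
  have : Fact q.Prime := ⟨hq⟩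
  exists_prime_orderOf_dvd_card' q (card_alternatingGroup_five ▸ h)

lemma card_map_sylow_two {D : Type*} [Group D] [Finite D] (f : D →* alternatingGroup (Fin 5))
    (hf : Function.Surjective f) [Fact (Nat.Prime 2)] (T : Sylow 2 D) :
    Nat.card (T.map f) = 4 := by
  have h := (T.mapSurjective hf).card_eq_multiplicity
  rw [card_alternatingGroup_five] at h
  have h60 : (60 : ℕ).factorization 2 = 2 := by
    have : (60 : ℕ) = 2 ^ 2 * 15 := by norm_num
    rw [this, Nat.factorization_mul (by norm_num) (by norm_num), Finsupp.add_apply,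
      Nat.Prime.factorization_pow Nat.prime_two, Finsupp.single_eq_same,
      Nat.factorization_eq_zero_of_not_dvd (by norm_num)]
  rwa [h60] at h

/-- An element of prime order `p > 3` acting on a normal subgroup that is an extension
by `A₅` centralizes an involution. -/
lemma exists_orderOf_eq_two_mul_of_dvd_quotient {G R : Type*} [Group G] [Finite G] [Group R]
    (q : G →* R) (hq : Function.Surjective q) (f : q.ker →* alternatingGroup (Fin 5))
    (hf : Function.Surjective f) (h6 : ∀ g : G, orderOf g ≠ 6) {p : ℕ} (hp : p.Prime)
    (hp2 : p ≠ 2) (hp3 : p ≠ 3) (hpR : p ∣ Nat.card R) : ∃ g : G, orderOf g = 2 * p := by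
  have p2 : Fact (Nat.Prime 2) := ⟨Nat.prime_two⟩
  have : Fact p.Prime := ⟨hp⟩
  have := alternatingGroup.isSimpleGroup (α := Fin 5) (by simp)
  let T : Sylow 2 q.ker := default
  obtain ⟨y, hyT, hy⟩ := exists_mem_normalizer_orderOf q hq T hpR
  have hyT' : ∀ x : q.ker, x ∈ T ↔ MulAut.conjNormal y x ∈ T := by
    intro x
    have := Subgroup.mem_normalizer_iff.1 hyT x
    rwa [← MulAut.conjNormal_apply, ← Subgroup.subtype_apply, ← Subgroup.subtype_apply,
      Subgroup.mem_map_iff_mem q.ker.subtype_injective,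
      Subgroup.mem_map_iff_mem q.ker.subtype_injective] at this
  let σ : MulAut q.ker := MulAut.conjNormal y
  let τ : Equiv.Perm T := 
    Equiv.Perm.subtypePerm (p := (· ∈ T)) σ.toEquiv fun x ↦ (hyT' x).symm
  have hτ : τ ^ p = 1 := by
    have hpow : ∀ (m : ℕ) (x : T), ((τ ^ m) x : q.ker) = (σ ^ m) x := by
      intro m
      induction m with
      | zero => simp
      | succ m ih =>
        intro x
        rw [pow_succ', pow_succ', Equiv.Perm.mul_apply, MulAut.mul_apply, ← ih]
        rfl
    ext x
    rw [hpow, ← map_pow, ← hy, pow_orderOf_eq_one, map_one]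
    rfl
  obtain ⟨x, hx1, hx⟩ := exists_fixed_point_of_card_range_eq_four
    (f.comp T.toSubgroup.subtype) T.2
    (by rw [MonoidHom.range_comp, Subgroup.range_subtype]; exact card_map_sylow_two f hf T)
    hp hp2 hp3 τ hτ fun x hx hx' ↦ hx <|
      apply_eq_one_of_apply_mulAut_eq_one f hf
        (exists_orderOf_alternatingGroup_five Nat.prime_two (by norm_num))
        (exists_orderOf_alternatingGroup_five Nat.prime_three (by norm_num))
        (fun g hg ↦ h6 g (by rw [Subgroup.orderOf_coe, hg])) σ hx'
  have hcomm : Commute y (x : q.ker) :=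
    conjNormal_apply_eq_self_iff.1 (congrArg Subtype.val hx : _)
  have h2 : 2 ∣ orderOf x := by
    obtain ⟨k, hk⟩ := IsPGroup.iff_orderOf.1 T.2 x
    rw [hk]
    refine dvd_pow_self 2 fun h ↦ hx1 ?_
    rw [← orderOf_eq_one_iff, hk, h, pow_zero]
  have hord : orderOf ((x : q.ker) : G) = orderOf x := by
    rw [Subgroup.orderOf_coe, Subgroup.orderOf_coe]
  rw [← hord] at h2
  exact exists_orderOf_eq_mul_of_commute (orderOf_pow_orderOf_div (orderOf_pos _).ne' h2) hy
    (hcomm.symm.pow_left _) ((Nat.coprime_primes Nat.prime_two hp).2 hp2.symm)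

set_option maxRecDepth 100000 in
lemma alternatingGroup_five_sq_eq_one :
    ∀ x : alternatingGroup (Fin 5), x ^ 4 = 1 → x ^ 2 = 1 := by
  decide

lemma exists_orderOf_eq_six_of_unique_involution {H : Type*} [Group H] [Finite H]
    (g : H →* alternatingGroup (Fin 5)) (hg : Function.Surjective g)
    (huniq : ∀ s t : H, orderOf s = 2 → orderOf t = 2 → Commute s t → s = t) :
    ∃ x : H, orderOf x = 6 := by
  have p2 : Fact (Nat.Prime 2) := ⟨Nat.prime_two⟩
  have p3 : Fact (Nat.Prime 3) := ⟨Nat.prime_three⟩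
  by_cases h2 : 2 ∣ Nat.card g.ker
  · let Q : Sylow 2 g.ker := default
    have hQ : Q.map g.ker.subtype ≠ ⊥ := by
      rw [Ne, Subgroup.map_eq_bot_iff_of_injective _ g.ker.subtype_injective]
      exact Q.ne_bot_of_dvd_card h2
    obtain ⟨z, hzQ, hz, hzc⟩ := exists_mem_center_orderOf_eq _ (Q.2.map _) hQ
    obtain ⟨y, hyQ, hy⟩ := exists_mem_normalizer_orderOf g hg Q (b := 3)
      (by rw [card_alternatingGroup_five]; norm_num)
    have hconj := (Subgroup.mem_normalizer_iff.1 hyQ z).1 hzQ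
    have heq := huniq z (y * z * y⁻¹) hz
      (by rw [← MulAut.conj_apply, MulEquiv.orderOf_eq, hz]) (hzc _ hconj)
    have hc : Commute z y := by
      rw [eq_mul_inv_iff_mul_eq] at heq
      exact heq
    exact exists_orderOf_eq_mul_of_commute hz hy hc (by norm_num)
  · exfalso
    let T : Sylow 2 H := default
    have hcard := card_map_sylow_two g hg T
    have hinj : ∀ t ∈ T, g t = 1 → t = 1 := by
      intro t ht hgt
      obtain ⟨k, hk⟩ := IsPGroup.iff_orderOf.1 T.2 ⟨t, ht⟩
      rw [← Subgroup.orderOf_coe] at hk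
      have hdvd : orderOf t ∣ Nat.card g.ker := by
        have := orderOf_dvd_natCard (⟨t, hgt⟩ : g.ker)
        rwa [← Subgroup.orderOf_coe] at this
      have hk0 : k = 0 := by
        by_contra hk0
        exact h2 ((hk ▸ dvd_pow_self 2 hk0).trans hdvd)
      rw [← orderOf_eq_one_iff, hk, hk0, pow_zero]
    have hgsq : ∀ t ∈ T, g t ^ 2 = 1 := by
      intro t ht
      apply alternatingGroup_five_sq_eq_one
      have := pow_card_eq_one' (x := (⟨g t, Subgroup.mem_map_of_mem g ht⟩ : T.map g))
      rw [hcard] at this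
      exact congrArg Subtype.val this
    have hsq : ∀ t ∈ T, t ^ 2 = 1 := fun t ht ↦
      hinj _ (pow_mem ht 2) (by rw [map_pow, hgsq t ht])
    have hex : ∀ s ∈ T, ∃ t ∈ T, t ∉ Subgroup.zpowers s := by
      intro s hs
      by_contra! hcon
      have hle : T.map g ≤ Subgroup.zpowers (g s) := by
        rw [← MonoidHom.map_zpowers]
        exact Subgroup.map_mono hcon
      have h4 := Subgroup.card_dvd_of_le hle
      rw [hcard, Nat.card_zpowers] at h4
      exact absurd (h4.trans (orderOf_dvd_of_pow_eq_one (hgsq s hs))) (by norm_num)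
    obtain ⟨s, hs, hs1⟩ := hex 1 (one_mem T)
    obtain ⟨t, ht, hts⟩ := hex s hs
    have hs0 : s ≠ 1 := fun h ↦ hs1 (h.symm ▸ one_mem _)
    have ht0 : t ≠ 1 := fun h ↦ hts (h.symm ▸ one_mem _)
    have hinv : ∀ x ∈ T, x⁻¹ = x := fun x hx ↦
      inv_eq_of_mul_eq_one_right (by rw [← sq, hsq x hx])
    have hc : Commute s t := by
      have := hinv _ (mul_mem hs ht)
      rw [mul_inv_rev, hinv s hs, hinv t ht] at this
      exact this.symm
    have := huniq s t (orderOf_eq_prime (hsq s hs) hs0) (orderOf_eq_prime (hsq t ht) ht0) hc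
    exact hts (this ▸ Subgroup.mem_zpowers s)

lemma exists_orderOf_of_dvd_card_ker {D : Type*} [Group D] [Finite D]
    (f : D →* alternatingGroup (Fin 5)) (hf : Function.Surjective f) {p : ℕ} (hp : p.Prime)
    (hp2 : p ≠ 2) (hpk : p ∣ Nat.card f.ker) :
    (∃ g : D, orderOf g = 2 * p) ∨ ∃ g : D, orderOf g = 6 := by
  have : Fact p.Prime := ⟨hp⟩
  refine or_iff_not_imp_left.2 fun hno ↦ ?_
  let P : Sylow p f.ker := default
  have hle := Subgroup.le_normalizer (H := P.map f.ker.subtype)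
  have hP1 : P.map f.ker.subtype ≠ ⊥ := by
    rw [Ne, Subgroup.map_eq_bot_iff_of_injective _ f.ker.subtype_injective]
    exact P.ne_bot_of_dvd_card hpk
  have hpP : IsPGroup p (P.map f.ker.subtype) := P.2.map _
  have hg := exists_mem_normalizer_map_eq f hf P
  generalize P.map f.ker.subtype = P' at *
  let N := P'.subgroupOf (Subgroup.normalizer (P' : Set D))
  have hN : N.Normal := Subgroup.normal_in_normalizer
  have hNp : IsPGroup p N := hpP.comap_subtype
  have hN1 : Nontrivial N := by
    rw [Subgroup.nontrivial_iff_ne_bot, Ne, Subgroup.subgroupOf_eq_bot, disjoint_iff,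
      inf_of_le_left hle]
    exact hP1
  have hfree : ∀ s : Subgroup.normalizer (P' : Set D), orderOf s = 2 →
      ∀ n : N, MulAut.conjNormal s n = n → n = 1 := by
    intro s hs n hn
    by_contra hn1
    rw [conjNormal_apply_eq_self_iff] at hn
    obtain ⟨k, hk⟩ := IsPGroup.iff_orderOf.1 hNp n
    have hpn : p ∣ orderOf (n : Subgroup.normalizer (P' : Set D)) := by
      rw [Subgroup.orderOf_coe, hk]
      refine dvd_pow_self p fun h ↦ hn1 ?_
      rw [← orderOf_eq_one_iff, hk, h, pow_zero]
    exact hno (exists_orderOf_eq_of_subgroup _ (exists_orderOf_eq_mul_of_commute hs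
      (orderOf_pow_orderOf_div (orderOf_pos _).ne' hpn) (hn.pow_right _)
      ((Nat.coprime_primes Nat.prime_two hp).2 hp2.symm)))
  have hinv : ∀ s : Subgroup.normalizer (P' : Set D), orderOf s = 2 →
      ∀ n : N, MulAut.conjNormal s n = n⁻¹ := fun s hs ↦
    apply_eq_inv_of_fixedPointFree _ (by rw [← map_pow, ← hs, pow_orderOf_eq_one, map_one])
      (hfree s hs)
  refine exists_orderOf_eq_of_subgroup (Subgroup.normalizer (P' : Set D))
    (exists_orderOf_eq_six_of_unique_involution (f.comp (Subgroup.subtype _)) ?_ ?_)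
  · intro q
    obtain ⟨x, hx, rfl⟩ := hg q
    exact ⟨⟨x, hx⟩, rfl⟩
  · intro s t hs ht hc
    by_contra hst
    have p2 : Fact (Nat.Prime 2) := ⟨Nat.prime_two⟩
    have hsq : ∀ x : Subgroup.normalizer (P' : Set D), orderOf x = 2 → x ^ 2 = 1 :=
      fun x hx ↦ by rw [← hx, pow_orderOf_eq_one]
    have hst2 : orderOf (s * t) = 2 := by
      refine orderOf_eq_prime (by rw [hc.mul_pow, hsq s hs, hsq t ht, one_mul]) fun h ↦ hst ?_
      rw [eq_inv_of_mul_eq_one_left h, inv_eq_of_mul_eq_one_right (by rw [← sq, hsq t ht])]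
    obtain ⟨n, hn⟩ := exists_ne (1 : N)
    refine hn (hfree _ hst2 n ?_)
    rw [map_mul, MulAut.mul_apply, hinv t ht, map_inv, hinv s hs, inv_inv]

lemma exists_normal_commutator_eq_self (G : Type*) [Group G] [Finite G]
    (hG : ¬ Group.IsSolvable G) : ∃ D : Subgroup G, D.Normal ∧ D ≠ ⊥ ∧ ⁅D, D⁆ = D := by
  obtain ⟨n, hn⟩ := WellFoundedLT.antitone_chain_condition (derivedSeries_antitone G)
  exact ⟨derivedSeries G n, derivedSeries_normal G n, fun h ↦ hG ⟨n, h⟩,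
    (hn (n + 1) n.le_succ).symm⟩

lemma IsPseudoSolvable.exists_surjective_alternatingGroup {G : Type*} [Group G]
    (hG : IsPseudoSolvable G) (D : Subgroup G) [D.Normal] (hD1 : D ≠ ⊥) (hD : ⁅D, D⁆ = D) :
    ∃ f : D →* alternatingGroup (Fin 5), Function.Surjective f := by
  obtain ⟨n, c, h0, hlast, hc⟩ := hG
  suffices h : ∀ i, D ≤ c i → ∃ f : D →* alternatingGroup (Fin 5), Function.Surjective f from
    h (Fin.last n) (hlast ▸ le_top)
  intro i
  induction i using Fin.induction with
  | zero => exact fun h ↦ absurd (le_bot_iff.1 (h0 ▸ h)) hD1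
  | succ i ih =>
    intro hDi
    by_cases hDi' : D ≤ c i.castSucc
    · exact ih hDi'
    obtain ⟨-, S, _, f, hf, hker, hS, hfac⟩ := hc i
    let g : D →* S := f.comp (Subgroup.inclusion hDi)
    have hgker : ∀ x : D, g x = 1 → (x : G) ∈ c i.castSucc := by
      intro x hx
      have : Subgroup.inclusion hDi x ∈ f.ker := hx
      rw [hker, Subgroup.mem_subgroupOf] at this
      exact this
    have hrange : g.range = (D.subgroupOf (c i.succ)).map f := by
      rw [MonoidHom.range_comp, Subgroup.inclusion_range]
    have hnorm : g.range.Normal := by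
      rw [hrange]
      exact (inferInstance : (D.subgroupOf (c i.succ)).Normal).map f hf
    have hgs : Function.Surjective g := by
      rw [← MonoidHom.range_eq_top]
      refine hnorm.eq_bot_or_eq_top.resolve_left fun h ↦ hDi' fun x hx ↦ ?_
      refine hgker ⟨x, hx⟩ ?_
      rw [← Subgroup.mem_bot, ← h]
      exact ⟨_, rfl⟩
    rcases hfac with hcyc | ⟨⟨e⟩⟩
    · refine absurd ?_ hDi'
      rw [← hD, Subgroup.commutator_le]
      intro a ha b hb
      refine hgker (⟨a, ha⟩ * ⟨b, hb⟩ * ⟨a, ha⟩⁻¹ * ⟨b, hb⟩⁻¹) ?_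
      rw [map_mul, map_mul, map_mul, map_inv, map_inv, mul_inv_eq_one, mul_inv_eq_iff_eq_mul]
      exact IsMulCommutative.is_comm.comm _ _
    · exact ⟨e.toMonoidHom.comp g, e.surjective.comp hgs⟩

theorem exists_orderOf_eq_of_surjective_alternatingGroup {G : Type*} [Group G] [Finite G]
    (D : Subgroup G) [D.Normal] (f : D →* alternatingGroup (Fin 5)) (hf : Function.Surjective f)
    {p : ℕ} (hp : p.Prime) (hpG : p ∣ Nat.card G) (hp2 : p ≠ 2) (hp3 : p ≠ 3) (hp5 : p ≠ 5) :
    (∃ g : G, orderOf g = 6) ∨ ∃ g : G, orderOf g = 2 * p := by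
  refine or_iff_not_imp_left.2 fun h6 ↦ ?_
  obtain ⟨R, _, q, hq, rfl⟩ : ∃ (R : Type _) (_ : Group R) (q : G →* R),
      Function.Surjective q ∧ D = q.ker :=
    ⟨G ⧸ D, inferInstance, QuotientGroup.mk' D, QuotientGroup.mk'_surjective D,
      (QuotientGroup.ker_mk' D).symm⟩
  rw [card_eq_card_mul_card_ker q hq, hp.dvd_mul] at hpG
  rcases hpG with hpR | hpD
  · exact exists_orderOf_eq_two_mul_of_dvd_quotient q hq f hf (not_exists.1 h6) hp hp2 hp3 hpR
  · rw [card_eq_card_mul_card_ker f hf, card_alternatingGroup_five, hp.dvd_mul] at hpD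
    have hp60 : ¬ p ∣ 60 := by
      intro h
      rw [show 60 = 2 ^ 2 * 3 * 5 by norm_num, hp.dvd_mul, hp.dvd_mul] at h
      rcases h with (h | h) | h
      · exact hp2 ((Nat.prime_dvd_prime_iff_eq hp Nat.prime_two).1 (hp.dvd_of_dvd_pow h))
      · exact hp3 ((Nat.prime_dvd_prime_iff_eq hp Nat.prime_three).1 h)
      · exact hp5 ((Nat.prime_dvd_prime_iff_eq hp Nat.prime_five).1 h)
    rcases exists_orderOf_of_dvd_card_ker f hf hp hp2 (hpD.resolve_left hp60) with h | h
    · exact exists_orderOf_eq_of_subgroup _ h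
    · exact absurd (exists_orderOf_eq_of_subgroup _ h) h6

/-- For a finite pseudo-solvable group `G`, either `{2,3,5}` does not form a
triangle in the complement of the prime graph of `G`, or for every prime
`p ∉ {2,3,5}` dividing `|G|` the pair `2 - p` is not an edge of the complement of
the prime graph (i.e. if `2` also divides `|G|` then `G` has an element of order
`2 * p`). -/
theorem stmt_16 (G : Type*) [Group G] [Finite G] (hps : IsPseudoSolvable G) :
    ((∃ g : G, orderOf g = 6 ∨ orderOf g = 10 ∨ orderOf g = 15) ∨
      ¬ 2 ∣ Nat.card G ∨ ¬ 3 ∣ Nat.card G ∨ ¬ 5 ∣ Nat.card G) ∨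
    (∀ p : ℕ, p.Prime → p ∣ Nat.card G → p ≠ 2 → p ≠ 3 → p ≠ 5 →
      2 ∣ Nat.card G → ∃ g : G, orderOf g = 2 * p) := by
  by_cases hG : Group.IsSolvable G
  · left
    by_contra! hcon
    obtain ⟨hno, h2, h3, h5⟩ := hcon
    obtain ⟨g, hg⟩ := exists_orderOf_eq_of_isSolvable h2 h3 h5
    have := hno g
    tauto
  · obtain ⟨D, hDn, hD1, hD⟩ := exists_normal_commutator_eq_self G hG
    obtain ⟨f, hf⟩ := hps.exists_surjective_alternatingGroup D hD1 hD
    refine or_iff_not_imp_left.2 fun hno p hp hpG hp2 hp3 hp5 _ ↦ ?_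
    refine (exists_orderOf_eq_of_surjective_alternatingGroup D f hf hp hpG hp2 hp3
      hp5).resolve_left ?_
    rintro ⟨g, hg⟩
    exact hno (Or.inl ⟨g, Or.inl hg⟩)
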